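/- arXiv:1301.3350 — 2 statements merged into one kernel-verified Lean document; each statement's English description precedes it below -/
import Mathlib

section
/- On processes of CLL_R, the ready-simulation preorder coincides with the alternative ready-simulation preorder: p ⊑_RS q if and only if p ⊑_ALT q. -/
set_option autoImplicit false

namespace CLLR

/-- Terms of the calculus CLL_R.  `Act` is the set of visible actions;
labels are `Option Act`, with `none` playing the role of the internal action τ.
`pre α t` is the prefix α.t, `ext` is external choice □, `conj` is conjunction ∧,
`disj` is disjunction ∨, `par A` is CSP-style parallel composition ∥_A,
`var X` is a variable, and `recur X E` is the recursive term ⟨X|E⟩ where the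
recursive specification `E` is a finite list of equations `Z = t_Z`. -/
inductive Tm (Act : Type) : Type where
  | zero  : Tm Act
  | bot   : Tm Act
  | pre   : Option Act → Tm Act → Tm Act
  | ext   : Tm Act → Tm Act → Tm Act
  | conj  : Tm Act → Tm Act → Tm Act
  | disj  : Tm Act → Tm Act → Tm Act
  | par   : Set Act → Tm Act → Tm Act → Tm Act
  | var   : ℕ → Tm Act
  | recur : ℕ → List (ℕ × Tm Act) → Tm Act

namespace Tm

variable {Act : Type}

/-- Simultaneous substitution of terms for the free variables of a term.
Recursion variables bound by a recursive specification are not substituted. -/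
def subst (σ : ℕ → Tm Act) : Tm Act → Tm Act
  | zero => zero
  | bot => bot
  | pre α t => pre α (subst σ t)
  | ext t₁ t₂ => ext (subst σ t₁) (subst σ t₂)
  | conj t₁ t₂ => conj (subst σ t₁) (subst σ t₂)
  | disj t₁ t₂ => disj (subst σ t₁) (subst σ t₂)
  | par A t₁ t₂ => par A (subst σ t₁) (subst σ t₂)
  | var X => σ X
  | recur Y E =>
      recur Y (E.attach.map fun p =>
        (p.1.1, subst (fun Z => if Z ∈ E.map Prod.fst then var Z else σ Z) p.1.2))
  decreasing_by
    all_goals simp_wf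
    all_goals try omega
    all_goals
      (have h := List.sizeOf_lt_of_mem p.2
       obtain ⟨⟨a, b⟩, hp⟩ := p
       simp_all
       omega)

/-- `⟨t|E⟩`: replace every recursion variable `Z` of `E` occurring free in `t`
by `⟨Z|E⟩`. -/
def unfoldE (E : List (ℕ × Tm Act)) (t : Tm Act) : Tm Act :=
  subst (fun Z => if Z ∈ E.map Prod.fst then recur Z E else var Z) t

/-- Substitution `t{p/X}` of a single term `p` for the variable `X`. -/
def subst1 (X : ℕ) (p : Tm Act) (t : Tm Act) : Tm Act :=
  subst (fun Y => if Y = X then p else var Y) t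

/-- Substitution of the tuple `ps` for the variables `0, …, n-1`. -/
def substN (n : ℕ) (ps : Fin n → Tm Act) (t : Tm Act) : Tm Act :=
  subst (fun Y => if h : Y < n then ps ⟨Y, h⟩ else var Y) t

/-- τ-transitions of LTS(CLL_R) (the rules of the TSS producing τ-steps;
these rules have no negative premises). -/
inductive TauStep : Tm Act → Tm Act → Prop where
  | pre {t : Tm Act} : TauStep (pre none t) t
  | extL {t₁ t₁' t₂ : Tm Act} : TauStep t₁ t₁' → TauStep (ext t₁ t₂) (ext t₁' t₂)
  | extR {t₁ t₂ t₂' : Tm Act} : TauStep t₂ t₂' → TauStep (ext t₁ t₂) (ext t₁ t₂')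
  | conjL {t₁ t₁' t₂ : Tm Act} : TauStep t₁ t₁' → TauStep (conj t₁ t₂) (conj t₁' t₂)
  | conjR {t₁ t₂ t₂' : Tm Act} : TauStep t₂ t₂' → TauStep (conj t₁ t₂) (conj t₁ t₂')
  | disjL {t₁ t₂ : Tm Act} : TauStep (disj t₁ t₂) t₁
  | disjR {t₁ t₂ : Tm Act} : TauStep (disj t₁ t₂) t₂
  | parL {A : Set Act} {t₁ t₁' t₂ : Tm Act} :
      TauStep t₁ t₁' → TauStep (par A t₁ t₂) (par A t₁' t₂)
  | parR {A : Set Act} {t₁ t₂ t₂' : Tm Act} :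
      TauStep t₂ t₂' → TauStep (par A t₁ t₂) (par A t₁ t₂')
  | recur {X : ℕ} {tX : Tm Act} {E : List (ℕ × Tm Act)} {q : Tm Act} :
      (X, tX) ∈ E → TauStep (unfoldE E tX) q → TauStep (Tm.recur X E) q

/-- A term is stable if it admits no τ-transition. -/
def Stable (p : Tm Act) : Prop := ∀ q : Tm Act, ¬ TauStep p q

/-- Transitions labelled by visible actions (τ-transitions get priority over
visible ones via the stability side conditions, making the LTS τ-pure). -/
inductive VisStep : Tm Act → Act → Tm Act → Prop where
  | pre {a : Act} {t : Tm Act} : VisStep (pre (some a) t) a t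
  | extL {a : Act} {t₁ t₁' t₂ : Tm Act} :
      VisStep t₁ a t₁' → Stable t₂ → VisStep (ext t₁ t₂) a t₁'
  | extR {a : Act} {t₁ t₂ t₂' : Tm Act} :
      Stable t₁ → VisStep t₂ a t₂' → VisStep (ext t₁ t₂) a t₂'
  | conj {a : Act} {t₁ t₁' t₂ t₂' : Tm Act} :
      VisStep t₁ a t₁' → VisStep t₂ a t₂' → VisStep (conj t₁ t₂) a (conj t₁' t₂')
  | parL {a : Act} {A : Set Act} {t₁ t₁' t₂ : Tm Act} :
      a ∉ A → VisStep t₁ a t₁' → Stable t₂ → VisStep (par A t₁ t₂) a (par A t₁' t₂)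
  | parR {a : Act} {A : Set Act} {t₁ t₂ t₂' : Tm Act} :
      a ∉ A → Stable t₁ → VisStep t₂ a t₂' → VisStep (par A t₁ t₂) a (par A t₁ t₂')
  | parSync {a : Act} {A : Set Act} {t₁ t₁' t₂ t₂' : Tm Act} :
      a ∈ A → VisStep t₁ a t₁' → VisStep t₂ a t₂' →
      VisStep (par A t₁ t₂) a (par A t₁' t₂')
  | recur {a : Act} {X : ℕ} {tX : Tm Act} {E : List (ℕ × Tm Act)} {q : Tm Act} :
      (X, tX) ∈ E → VisStep (unfoldE E tX) a q → VisStep (Tm.recur X E) a q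

/-- The full transition relation of LTS(CLL_R); the label `none` is τ. -/
def Trans (p : Tm Act) (α : Option Act) (q : Tm Act) : Prop :=
  match α with
  | none => TauStep p q
  | some a => VisStep p a q

/-- `p ⟹ε q`: a finite sequence of τ-transitions. -/
def Eps (p q : Tm Act) : Prop := Relation.ReflTransGen TauStep p q

/-- The ready set `I(p)` of a term. -/
def ready (p : Tm Act) : Set (Option Act) := {α | ∃ q, Trans p α q}

/-- The inconsistency predicate F of LTS(CLL_R), defined by the predicate rules
Rp1–Rp15 (interpreted over the already-determined transition relation, which
yields the unique stable model of the stratified TSS). -/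
inductive Fpred : Tm Act → Prop where
  | bot : Fpred Tm.bot
  | pre {α : Option Act} {t : Tm Act} : Fpred t → Fpred (Tm.pre α t)
  | disj {t₁ t₂ : Tm Act} : Fpred t₁ → Fpred t₂ → Fpred (Tm.disj t₁ t₂)
  | extL {t₁ t₂ : Tm Act} : Fpred t₁ → Fpred (Tm.ext t₁ t₂)
  | extR {t₁ t₂ : Tm Act} : Fpred t₂ → Fpred (Tm.ext t₁ t₂)
  | parL {A : Set Act} {t₁ t₂ : Tm Act} : Fpred t₁ → Fpred (Tm.par A t₁ t₂)
  | parR {A : Set Act} {t₁ t₂ : Tm Act} : Fpred t₂ → Fpred (Tm.par A t₁ t₂)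
  | conjL {t₁ t₂ : Tm Act} : Fpred t₁ → Fpred (Tm.conj t₁ t₂)
  | conjR {t₁ t₂ : Tm Act} : Fpred t₂ → Fpred (Tm.conj t₁ t₂)
  | conjSyncL {a : Act} {t₁ t₂ q : Tm Act} :
      VisStep t₁ a q → (∀ q', ¬ VisStep t₂ a q') → Stable (Tm.conj t₁ t₂) →
      Fpred (Tm.conj t₁ t₂)
  | conjSyncR {a : Act} {t₁ t₂ q : Tm Act} :
      (∀ q', ¬ VisStep t₁ a q') → VisStep t₂ a q → Stable (Tm.conj t₁ t₂) →
      Fpred (Tm.conj t₁ t₂)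
  | conjDeriv {α : Option Act} {t₁ t₂ q : Tm Act} :
      Trans (Tm.conj t₁ t₂) α q → (∀ q', Trans (Tm.conj t₁ t₂) α q' → Fpred q') →
      Fpred (Tm.conj t₁ t₂)
  | conjTau {t₁ t₂ : Tm Act} :
      (∀ q, Eps (Tm.conj t₁ t₂) q → Stable q → Fpred q) → Fpred (Tm.conj t₁ t₂)
  | recUnfold {X : ℕ} {tX : Tm Act} {E : List (ℕ × Tm Act)} :
      (X, tX) ∈ E → Fpred (unfoldE E tX) → Fpred (Tm.recur X E)
  | recTau {X : ℕ} {E : List (ℕ × Tm Act)} :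
      (∀ q, Eps (Tm.recur X E) q → Stable q → Fpred q) → Fpred (Tm.recur X E)

/-- `p ⟹ε_F q`: a finite sequence of τ-transitions all of whose states,
including the endpoints, are consistent (outside F). -/
inductive TauSeqF : Tm Act → Tm Act → Prop where
  | refl {p : Tm Act} : ¬ Fpred p → TauSeqF p p
  | step {p q r : Tm Act} : ¬ Fpred p → TauStep p q → TauSeqF q r → TauSeqF p r

/-- `p ⟹ε_F| q`. -/
def WEpsF (p q : Tm Act) : Prop := TauSeqF p q ∧ Stable q

/-- `p ⟹a_F| q`. -/
def WActF (a : Act) (p q : Tm Act) : Prop :=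
  ∃ r s, TauSeqF p r ∧ VisStep r a s ∧ TauSeqF s q ∧ Stable q

/-- Stable ready simulation relations (Def. 2.3). -/
def IsStableRS (R : Tm Act → Tm Act → Prop) : Prop :=
  ∀ p q, R p q →
    Stable p ∧ Stable q ∧
    (¬ Fpred p → ¬ Fpred q) ∧
    (∀ (a : Act) (p' : Tm Act), WActF a p p' → ∃ q', WActF a q q' ∧ R p' q') ∧
    (¬ Fpred p → ready p = ready q)

/-- `p ⊏̰_RS q`: p is stable ready simulated by q. -/
def SRS (p q : Tm Act) : Prop := ∃ R, IsStableRS R ∧ R p q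

/-- `p ⊑_RS q`: the ready simulation preorder. -/
def RSle (p q : Tm Act) : Prop :=
  ∀ p', WEpsF p p' → ∃ q', WEpsF q q' ∧ SRS p' q'

/-- `p =_RS q`: the kernel of ⊑_RS. -/
def RSeq (p q : Tm Act) : Prop := RSle p q ∧ RSle q p

/-- Alternative ready simulation relations (Def. 6.1). -/
def IsAltRS (R : Tm Act → Tm Act → Prop) : Prop :=
  ∀ p q, R p q →
    (∀ p', WEpsF p p' → ∃ q', WEpsF q q' ∧ R p' q') ∧
    (∀ (a : Act) (p' : Tm Act), Stable p → Stable q → WActF a p p' →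
        ∃ q', WActF a q q' ∧ R p' q') ∧
    (Stable p → Stable q → ¬ Fpred p → ready p = ready q)

/-- `p ⊑_ALT q`. -/
def ALTle (p q : Tm Act) : Prop := ∃ R, IsAltRS R ∧ R p q

/-- `ClosedUnder V t`: all free variables of `t` belong to `V`. -/
inductive ClosedUnder : Set ℕ → Tm Act → Prop where
  | zero {V : Set ℕ} : ClosedUnder V Tm.zero
  | bot {V : Set ℕ} : ClosedUnder V Tm.bot
  | var {V : Set ℕ} {X : ℕ} : X ∈ V → ClosedUnder V (Tm.var X)
  | pre {V : Set ℕ} {α : Option Act} {t : Tm Act} :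
      ClosedUnder V t → ClosedUnder V (Tm.pre α t)
  | ext {V : Set ℕ} {t₁ t₂ : Tm Act} :
      ClosedUnder V t₁ → ClosedUnder V t₂ → ClosedUnder V (Tm.ext t₁ t₂)
  | conj {V : Set ℕ} {t₁ t₂ : Tm Act} :
      ClosedUnder V t₁ → ClosedUnder V t₂ → ClosedUnder V (Tm.conj t₁ t₂)
  | disj {V : Set ℕ} {t₁ t₂ : Tm Act} :
      ClosedUnder V t₁ → ClosedUnder V t₂ → ClosedUnder V (Tm.disj t₁ t₂)
  | par {V : Set ℕ} {A : Set Act} {t₁ t₂ : Tm Act} :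
      ClosedUnder V t₁ → ClosedUnder V t₂ → ClosedUnder V (Tm.par A t₁ t₂)
  | recur {V : Set ℕ} {Y : ℕ} {E : List (ℕ × Tm Act)} :
      (∀ p ∈ E, ClosedUnder (V ∪ {Z | Z ∈ E.map Prod.fst}) p.2) →
      ClosedUnder V (Tm.recur Y E)

/-- `GuardedIn V t`: every free occurrence in `t` of a variable from `V` is
(weakly or strongly) guarded, i.e. lies under a prefix or a disjunction. -/
inductive GuardedIn : Set ℕ → Tm Act → Prop where
  | zero {V : Set ℕ} : GuardedIn V Tm.zero
  | bot {V : Set ℕ} : GuardedIn V Tm.bot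
  | var {V : Set ℕ} {X : ℕ} : X ∉ V → GuardedIn V (Tm.var X)
  | pre {V : Set ℕ} {α : Option Act} {t : Tm Act} : GuardedIn V (Tm.pre α t)
  | disj {V : Set ℕ} {t₁ t₂ : Tm Act} : GuardedIn V (Tm.disj t₁ t₂)
  | ext {V : Set ℕ} {t₁ t₂ : Tm Act} :
      GuardedIn V t₁ → GuardedIn V t₂ → GuardedIn V (Tm.ext t₁ t₂)
  | conj {V : Set ℕ} {t₁ t₂ : Tm Act} :
      GuardedIn V t₁ → GuardedIn V t₂ → GuardedIn V (Tm.conj t₁ t₂)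
  | par {V : Set ℕ} {A : Set Act} {t₁ t₂ : Tm Act} :
      GuardedIn V t₁ → GuardedIn V t₂ → GuardedIn V (Tm.par A t₁ t₂)
  | recur {V : Set ℕ} {Y : ℕ} {E : List (ℕ × Tm Act)} :
      (∀ p ∈ E, GuardedIn (V \ {Z | Z ∈ E.map Prod.fst}) p.2) →
      GuardedIn V (Tm.recur Y E)

/-- `StronglyGuardedIn V t`: every free occurrence in `t` of a variable from
`V` is strongly guarded, i.e. lies under a prefix `a.t₁` with `a` a visible
action. -/
inductive StronglyGuardedIn : Set ℕ → Tm Act → Prop where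
  | zero {V : Set ℕ} : StronglyGuardedIn V Tm.zero
  | bot {V : Set ℕ} : StronglyGuardedIn V Tm.bot
  | var {V : Set ℕ} {X : ℕ} : X ∉ V → StronglyGuardedIn V (Tm.var X)
  | preVis {V : Set ℕ} {a : Act} {t : Tm Act} :
      StronglyGuardedIn V (Tm.pre (some a) t)
  | preTau {V : Set ℕ} {t : Tm Act} :
      StronglyGuardedIn V t → StronglyGuardedIn V (Tm.pre none t)
  | ext {V : Set ℕ} {t₁ t₂ : Tm Act} :
      StronglyGuardedIn V t₁ → StronglyGuardedIn V t₂ →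
      StronglyGuardedIn V (Tm.ext t₁ t₂)
  | conj {V : Set ℕ} {t₁ t₂ : Tm Act} :
      StronglyGuardedIn V t₁ → StronglyGuardedIn V t₂ →
      StronglyGuardedIn V (Tm.conj t₁ t₂)
  | disj {V : Set ℕ} {t₁ t₂ : Tm Act} :
      StronglyGuardedIn V t₁ → StronglyGuardedIn V t₂ →
      StronglyGuardedIn V (Tm.disj t₁ t₂)
  | par {V : Set ℕ} {A : Set Act} {t₁ t₂ : Tm Act} :
      StronglyGuardedIn V t₁ → StronglyGuardedIn V t₂ →
      StronglyGuardedIn V (Tm.par A t₁ t₂)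
  | recur {V : Set ℕ} {Y : ℕ} {E : List (ℕ × Tm Act)} :
      (∀ p ∈ E, StronglyGuardedIn (V \ {Z | Z ∈ E.map Prod.fst}) p.2) →
      StronglyGuardedIn V (Tm.recur Y E)

/-- `NotFree V t`: no variable of `V` occurs free in `t`. -/
inductive NotFree : Set ℕ → Tm Act → Prop where
  | zero {V : Set ℕ} : NotFree V Tm.zero
  | bot {V : Set ℕ} : NotFree V Tm.bot
  | var {V : Set ℕ} {X : ℕ} : X ∉ V → NotFree V (Tm.var X)
  | pre {V : Set ℕ} {α : Option Act} {t : Tm Act} :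
      NotFree V t → NotFree V (Tm.pre α t)
  | ext {V : Set ℕ} {t₁ t₂ : Tm Act} :
      NotFree V t₁ → NotFree V t₂ → NotFree V (Tm.ext t₁ t₂)
  | conj {V : Set ℕ} {t₁ t₂ : Tm Act} :
      NotFree V t₁ → NotFree V t₂ → NotFree V (Tm.conj t₁ t₂)
  | disj {V : Set ℕ} {t₁ t₂ : Tm Act} :
      NotFree V t₁ → NotFree V t₂ → NotFree V (Tm.disj t₁ t₂)
  | par {V : Set ℕ} {A : Set Act} {t₁ t₂ : Tm Act} :
      NotFree V t₁ → NotFree V t₂ → NotFree V (Tm.par A t₁ t₂)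
  | recur {V : Set ℕ} {Y : ℕ} {E : List (ℕ × Tm Act)} :
      (∀ p ∈ E, NotFree (V \ {Z | Z ∈ E.map Prod.fst}) p.2) →
      NotFree V (Tm.recur Y E)

/-- `ConjFree V t`: no variable of `V` occurs (free) in the scope of any
conjunction in `t`. -/
inductive ConjFree : Set ℕ → Tm Act → Prop where
  | zero {V : Set ℕ} : ConjFree V Tm.zero
  | bot {V : Set ℕ} : ConjFree V Tm.bot
  | var {V : Set ℕ} {X : ℕ} : ConjFree V (Tm.var X)
  | pre {V : Set ℕ} {α : Option Act} {t : Tm Act} :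
      ConjFree V t → ConjFree V (Tm.pre α t)
  | ext {V : Set ℕ} {t₁ t₂ : Tm Act} :
      ConjFree V t₁ → ConjFree V t₂ → ConjFree V (Tm.ext t₁ t₂)
  | disj {V : Set ℕ} {t₁ t₂ : Tm Act} :
      ConjFree V t₁ → ConjFree V t₂ → ConjFree V (Tm.disj t₁ t₂)
  | par {V : Set ℕ} {A : Set Act} {t₁ t₂ : Tm Act} :
      ConjFree V t₁ → ConjFree V t₂ → ConjFree V (Tm.par A t₁ t₂)
  | conj {V : Set ℕ} {t₁ t₂ : Tm Act} :
      NotFree V t₁ → NotFree V t₂ → ConjFree V (Tm.conj t₁ t₂)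
  | recur {V : Set ℕ} {Y : ℕ} {E : List (ℕ × Tm Act)} :
      (∀ p ∈ E, ConjFree (V \ {Z | Z ∈ E.map Prod.fst}) p.2) →
      ConjFree V (Tm.recur Y E)

/-- Well-formed terms: every recursive specification occurring in the term is
nonempty, guarded (Convention 2), declares its distinguished variable, and has
well-formed bodies. -/
inductive WF : Tm Act → Prop where
  | zero : WF Tm.zero
  | bot : WF Tm.bot
  | var {X : ℕ} : WF (Tm.var X)
  | pre {α : Option Act} {t : Tm Act} : WF t → WF (Tm.pre α t)
  | ext {t₁ t₂ : Tm Act} : WF t₁ → WF t₂ → WF (Tm.ext t₁ t₂)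
  | conj {t₁ t₂ : Tm Act} : WF t₁ → WF t₂ → WF (Tm.conj t₁ t₂)
  | disj {t₁ t₂ : Tm Act} : WF t₁ → WF t₂ → WF (Tm.disj t₁ t₂)
  | par {A : Set Act} {t₁ t₂ : Tm Act} : WF t₁ → WF t₂ → WF (Tm.par A t₁ t₂)
  | recur {Y : ℕ} {E : List (ℕ × Tm Act)} :
      E ≠ [] → Y ∈ E.map Prod.fst →
      (∀ p ∈ E, WF p.2) →
      (∀ p ∈ E, GuardedIn {Z | Z ∈ E.map Prod.fst} p.2) →
      WF (Tm.recur Y E)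

/-- A process is a closed well-formed term. -/
def IsProcess (t : Tm Act) : Prop := ClosedUnder ∅ t ∧ WF t

/-- A context over the variables `V` is a well-formed term all of whose free
variables belong to `V`. -/
def IsContext (V : Set ℕ) (t : Tm Act) : Prop := ClosedUnder V t ∧ WF t

/-- One-step unfolding: replace one occurrence of a recursive term `⟨Y|E⟩`
that is not in the scope of any recursive operation by `⟨t_Y|E⟩`. -/
inductive Unf1 : Tm Act → Tm Act → Prop where
  | recur {Y : ℕ} {tY : Tm Act} {E : List (ℕ × Tm Act)} :
      (Y, tY) ∈ E → Unf1 (Tm.recur Y E) (unfoldE E tY)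
  | pre {α : Option Act} {t t' : Tm Act} : Unf1 t t' → Unf1 (Tm.pre α t) (Tm.pre α t')
  | extL {t₁ t₁' t₂ : Tm Act} : Unf1 t₁ t₁' → Unf1 (Tm.ext t₁ t₂) (Tm.ext t₁' t₂)
  | extR {t₁ t₂ t₂' : Tm Act} : Unf1 t₂ t₂' → Unf1 (Tm.ext t₁ t₂) (Tm.ext t₁ t₂')
  | conjL {t₁ t₁' t₂ : Tm Act} : Unf1 t₁ t₁' → Unf1 (Tm.conj t₁ t₂) (Tm.conj t₁' t₂)
  | conjR {t₁ t₂ t₂' : Tm Act} : Unf1 t₂ t₂' → Unf1 (Tm.conj t₁ t₂) (Tm.conj t₁ t₂')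
  | disjL {t₁ t₁' t₂ : Tm Act} : Unf1 t₁ t₁' → Unf1 (Tm.disj t₁ t₂) (Tm.disj t₁' t₂)
  | disjR {t₁ t₂ t₂' : Tm Act} : Unf1 t₂ t₂' → Unf1 (Tm.disj t₁ t₂) (Tm.disj t₁ t₂')
  | parL {A : Set Act} {t₁ t₁' t₂ : Tm Act} :
      Unf1 t₁ t₁' → Unf1 (Tm.par A t₁ t₂) (Tm.par A t₁' t₂)
  | parR {A : Set Act} {t₁ t₂ t₂' : Tm Act} :
      Unf1 t₂ t₂' → Unf1 (Tm.par A t₁ t₂) (Tm.par A t₁ t₂')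

/-- Multi-step unfolding `⇛`: the reflexive transitive closure of `⇛₁`. -/
def Unf : Tm Act → Tm Act → Prop := Relation.ReflTransGen Unf1


theorem TauSeqF.notF_left {Act : Type} {p q : Tm Act} (h : TauSeqF p q) : ¬ Fpred p := by
  cases h <;> assumption

theorem TauSeqF.notF_right {Act : Type} {p q : Tm Act} (h : TauSeqF p q) : ¬ Fpred q := by
  induction h <;> assumption

theorem TauSeqF.eq_of_stable {Act : Type} {p q : Tm Act} (h : TauSeqF p q) (hs : Stable p) :
    q = p := by
  cases h with
  | refl => rfl
  | step _ ht _ => exact absurd ht (hs _)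

/-- Stable ready simulation implies ready simulation. -/
theorem SRS.rsle {Act : Type} {p q : Tm Act} (h : SRS p q) : RSle p q := by
  intro p' hp'
  obtain ⟨R, hR, hpq⟩ := id h
  obtain ⟨sp, sq, hF, -, -⟩ := hR p q hpq
  obtain rfl := hp'.1.eq_of_stable sp
  exact ⟨q, ⟨.refl (hF hp'.1.notF_left), sq⟩, h⟩

/-- On stable consistent terms, ready simulation implies stable ready simulation. -/
theorem RSle.srs {Act : Type} {p q : Tm Act} (h : RSle p q) (sp : Stable p) (sq : Stable q)
    (hF : ¬ Fpred p) : SRS p q := by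
  obtain ⟨q', hq', hs⟩ := h p ⟨.refl hF, sp⟩
  obtain rfl := hq'.1.eq_of_stable sq
  exact hs

theorem isAltRS_rsle {Act : Type} : IsAltRS (RSle (Act := Act)) := by
  intro p q h
  refine ⟨fun p' hp' => ?_, fun a p' sp sq hp' => ?_, fun sp sq hF => ?_⟩
  · obtain ⟨q', hq', hs⟩ := h p' hp'
    exact ⟨q', hq', hs.rsle⟩
  · have hF : ¬ Fpred p := by
      obtain ⟨r, s, h1, -⟩ := hp'
      exact h1.notF_left
    obtain ⟨R, hR, hpq⟩ := h.srs sp sq hF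
    obtain ⟨q', hq', hr⟩ := (hR p q hpq).2.2.2.1 a p' hp'
    exact ⟨q', hq', SRS.rsle ⟨R, hR, hr⟩⟩
  · obtain ⟨R, hR, hpq⟩ := h.srs sp sq hF
    exact (hR p q hpq).2.2.2.2 hF

theorem IsAltRS.isStableRS {Act : Type} {R : Tm Act → Tm Act → Prop} (hR : IsAltRS R) :
    IsStableRS (fun p q => Stable p ∧ Stable q ∧ ¬ Fpred q ∧ R p q) := by
  rintro p q ⟨sp, sq, hF, h⟩
  refine ⟨sp, sq, fun _ => hF, fun a p' hp' => ?_, (hR p q h).2.2 sp sq⟩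
  obtain ⟨q', hq', hr⟩ := (hR p q h).2.1 a p' sp sq hp'
  refine ⟨q', hq', ?_⟩
  obtain ⟨_, _, _, _, _, sp'⟩ := hp'
  obtain ⟨_, _, _, _, hq1, sq'⟩ := hq'
  exact ⟨sp', sq', hq1.notF_right, hr⟩

/-- the ready-simulation preorder coincides with the alternative
ready-simulation preorder. -/
theorem rsle_iff_altle {Act : Type} (p q : Tm Act)
    (hp : IsProcess p) (hq : IsProcess q) :
    RSle p q ↔ ALTle p q := by
  constructor
  · intro h
    exact ⟨RSle, isAltRS_rsle, h⟩
  · rintro ⟨R, hR, h⟩ p' hp'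
    obtain ⟨q', hq', hr⟩ := (hR p q h).1 p' hp'
    exact ⟨q', hq', _, hR.isStableRS, hp'.2, hq'.2, hq'.1.notF_right, hr⟩

end Tm
end CLLR
end

section
/- Let C_X̃ be a context of CLL_R and let p̃, q̃ be tuples of processes with p_i ⊑_RS q_i for each i. If C_X̃{p̃/X̃} and C_X̃{q̃/X̃} are both stable and C_X̃{p̃/X̃} ∉ F, then for every visible action a ∈ Act, C_X̃{p̃/X̃} has an a-transition if and only if C_X̃{q̃/X̃} has an a-transition. -/
set_option autoImplicit false

namespace CLLR

namespace Tm

variable {Act : Type}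

/-- Congruence-style closure of a base relation on terms. -/
inductive Rel (B : Tm Act → Tm Act → Prop) : Tm Act → Tm Act → Prop where
  | base {u v : Tm Act} : B u v → Rel B u v
  | zero : Rel B Tm.zero Tm.zero
  | bot : Rel B Tm.bot Tm.bot
  | var {X : ℕ} : Rel B (Tm.var X) (Tm.var X)
  | pre {α : Option Act} {t t' : Tm Act} : Rel B t t' → Rel B (Tm.pre α t) (Tm.pre α t')
  | ext {t₁ t₁' t₂ t₂' : Tm Act} :
      Rel B t₁ t₁' → Rel B t₂ t₂' → Rel B (Tm.ext t₁ t₂) (Tm.ext t₁' t₂')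
  | conj {t₁ t₁' t₂ t₂' : Tm Act} :
      Rel B t₁ t₁' → Rel B t₂ t₂' → Rel B (Tm.conj t₁ t₂) (Tm.conj t₁' t₂')
  | disj {t₁ t₁' t₂ t₂' : Tm Act} :
      Rel B t₁ t₁' → Rel B t₂ t₂' → Rel B (Tm.disj t₁ t₂) (Tm.disj t₁' t₂')
  | par {A : Set Act} {t₁ t₁' t₂ t₂' : Tm Act} :
      Rel B t₁ t₁' → Rel B t₂ t₂' → Rel B (Tm.par A t₁ t₂) (Tm.par A t₁' t₂')
  | recur {Y : ℕ} (L : List (ℕ × Tm Act × Tm Act)) :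
      (∀ e ∈ L, Rel B e.2.1 e.2.2) →
      Rel B (Tm.recur Y (L.map fun e => (e.1, e.2.1)))
        (Tm.recur Y (L.map fun e => (e.1, e.2.2)))

theorem subst_recur (σ : ℕ → Tm Act) (Y : ℕ) (E : List (ℕ × Tm Act)) :
    subst σ (Tm.recur Y E) = Tm.recur Y (E.map fun e =>
      (e.1, subst (fun Z => if Z ∈ E.map Prod.fst then Tm.var Z else σ Z) e.2)) := by
  rw [subst]
  congr 1
  exact List.attach_map_val (l := E) (f := fun e : ℕ × Tm Act =>
      (e.1, subst (fun Z => if Z ∈ E.map Prod.fst then Tm.var Z else σ Z) e.2))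

theorem subst_closed {V : Set ℕ} {t : Tm Act} (h : ClosedUnder V t) :
    ∀ σ : ℕ → Tm Act, (∀ Z ∈ V, σ Z = Tm.var Z) → subst σ t = t := by
  induction h with
  | zero => intro σ _; rw [subst]
  | bot => intro σ _; rw [subst]
  | var hX => intro σ hσ; rw [subst]; exact hσ _ hX
  | pre _ ih => intro σ hσ; rw [subst, ih σ hσ]
  | ext _ _ ih1 ih2 => intro σ hσ; rw [subst, ih1 σ hσ, ih2 σ hσ]
  | conj _ _ ih1 ih2 => intro σ hσ; rw [subst, ih1 σ hσ, ih2 σ hσ]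
  | disj _ _ ih1 ih2 => intro σ hσ; rw [subst, ih1 σ hσ, ih2 σ hσ]
  | par _ _ ih1 ih2 => intro σ hσ; rw [subst, ih1 σ hσ, ih2 σ hσ]
  | @recur V Y E _ ih =>
    intro σ hσ
    rw [subst_recur]
    congr 1
    conv_rhs => rw [← List.map_id E]
    apply List.map_congr_left
    intro e he
    rw [ih e he]
    · rfl
    · intro Z hZ
      by_cases hm : Z ∈ E.map Prod.fst
      · simp only [if_pos hm]
      · simp only [if_neg hm]
        rcases hZ with hZ | hZ
        · exact hσ Z hZ
        · exact absurd hZ hm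

theorem Rel.refl_closed (B : Tm Act → Tm Act → Prop) {V : Set ℕ} {t : Tm Act}
    (h : ClosedUnder V t) : Rel B t t := by
  induction h with
  | zero => exact .zero
  | bot => exact .bot
  | var hX => exact .var
  | pre _ ih => exact .pre ih
  | ext _ _ ih1 ih2 => exact .ext ih1 ih2
  | conj _ _ ih1 ih2 => exact .conj ih1 ih2
  | disj _ _ ih1 ih2 => exact .disj ih1 ih2
  | par _ _ ih1 ih2 => exact .par ih1 ih2
  | @recur V Y E _ ih =>
    have := Rel.recur (B := B) (Y := Y) (E.map fun e => (e.1, e.2, e.2)) (by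
      intro e he
      obtain ⟨e', he', rfl⟩ := List.mem_map.1 he
      exact ih e' he')
    simpa [List.map_map, Function.comp_def] using this

theorem Rel.subst {B : Tm Act → Tm Act → Prop}
    (hcl : ∀ u v, B u v → ClosedUnder ∅ u ∧ ClosedUnder ∅ v)
    {t t' : Tm Act} (h : Rel B t t') :
    ∀ σ ρ : ℕ → Tm Act, (∀ Z, Rel B (σ Z) (ρ Z)) →
      Rel B (Tm.subst σ t) (Tm.subst ρ t') := by
  induction h with
  | base hb =>
    intro σ ρ _
    rw [subst_closed (hcl _ _ hb).1 σ (by simp), subst_closed (hcl _ _ hb).2 ρ (by simp)]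
    exact .base hb
  | zero => intro σ ρ _; simp only [Tm.subst]; exact .zero
  | bot => intro σ ρ _; simp only [Tm.subst]; exact .bot
  | var => intro σ ρ h; simp only [Tm.subst]; exact h _
  | pre _ ih => intro σ ρ h; simp only [Tm.subst]; exact .pre (ih _ _ h)
  | ext _ _ ih1 ih2 =>
    intro σ ρ h; simp only [Tm.subst]; exact .ext (ih1 _ _ h) (ih2 _ _ h)
  | conj _ _ ih1 ih2 =>
    intro σ ρ h; simp only [Tm.subst]; exact .conj (ih1 _ _ h) (ih2 _ _ h)
  | disj _ _ ih1 ih2 =>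
    intro σ ρ h; simp only [Tm.subst]; exact .disj (ih1 _ _ h) (ih2 _ _ h)
  | par _ _ ih1 ih2 =>
    intro σ ρ h; simp only [Tm.subst]; exact .par (ih1 _ _ h) (ih2 _ _ h)
  | @recur Y L _ ih =>
    intro σ ρ h
    have key := Rel.recur (B := B) (Y := Y)
      (L.map fun e => (e.1,
        Tm.subst (fun Z => if Z ∈ L.map Prod.fst then Tm.var Z else σ Z) e.2.1,
        Tm.subst (fun Z => if Z ∈ L.map Prod.fst then Tm.var Z else ρ Z) e.2.2)) (by
      intro e he
      obtain ⟨e', he', rfl⟩ := List.mem_map.1 he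
      refine ih e' he' _ _ ?_
      intro Z
      by_cases hm : Z ∈ L.map Prod.fst
      · simp only [if_pos hm]; exact .var
      · simp only [if_neg hm]; exact h Z)
    rw [subst_recur, subst_recur]
    simp only [List.map_map, Function.comp_def] at key ⊢
    exact key

theorem Rel.unfold {B : Tm Act → Tm Act → Prop}
    (hcl : ∀ u v, B u v → ClosedUnder ∅ u ∧ ClosedUnder ∅ v)
    (L : List (ℕ × Tm Act × Tm Act)) (hL : ∀ e ∈ L, Rel B e.2.1 e.2.2)
    {t t' : Tm Act} (h : Rel B t t') :
    Rel B (unfoldE (L.map fun e => (e.1, e.2.1)) t)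
      (unfoldE (L.map fun e => (e.1, e.2.2)) t') := by
  refine Rel.subst hcl h _ _ ?_
  intro Z
  simp only [List.map_map, Function.comp_def]
  split_ifs
  · exact .recur L hL
  · exact .var

theorem Rel.visStep {B : Tm Act → Tm Act → Prop}
    (hcl : ∀ u v, B u v → ClosedUnder ∅ u ∧ ClosedUnder ∅ v)
    (c : Bool)
    (hB : ∀ u v, B u v → Stable u → Stable v → ¬ Fpred (cond c u v) →
      ∀ a, (∃ r, VisStep u a r) → ∃ r, VisStep v a r)
    {u : Tm Act} {a : Act} {r : Tm Act} (hstep : VisStep u a r) :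
    ∀ v, Rel B u v → Stable u → Stable v → ¬ Fpred (cond c u v) →
      ∃ r', VisStep v a r' := by
  induction hstep with
  | pre =>
    intro v hR hu hv hF
    cases hR with
    | base hb => exact hB _ _ hb hu hv hF _ ⟨_, .pre⟩
    | pre _ => exact ⟨_, .pre⟩
  | extL h1 h2 ih =>
    intro v hR hu hv hF
    cases hR with
    | base hb => exact hB _ _ hb hu hv hF _ ⟨_, .extL h1 h2⟩
    | ext r1 r2 =>
      obtain ⟨r', hr'⟩ := ih _ r1 (fun _ h => hu _ (.extL h)) (fun _ h => hv _ (.extL h))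
        (fun h => hF (by cases c <;> exact .extL h))
      exact ⟨_, .extL hr' (fun _ h => hv _ (.extR h))⟩
  | extR h1 h2 ih =>
    intro v hR hu hv hF
    cases hR with
    | base hb => exact hB _ _ hb hu hv hF _ ⟨_, .extR h1 h2⟩
    | ext r1 r2 =>
      obtain ⟨r', hr'⟩ := ih _ r2 (fun _ h => hu _ (.extR h)) (fun _ h => hv _ (.extR h))
        (fun h => hF (by cases c <;> exact .extR h))
      exact ⟨_, .extR (fun _ h => hv _ (.extL h)) hr'⟩
  | conj h1 h2 ih1 ih2 =>
    intro v hR hu hv hF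
    cases hR with
    | base hb => exact hB _ _ hb hu hv hF _ ⟨_, .conj h1 h2⟩
    | conj r1 r2 =>
      obtain ⟨r', hr'⟩ := ih1 _ r1 (fun _ h => hu _ (.conjL h)) (fun _ h => hv _ (.conjL h))
        (fun h => hF (by cases c <;> exact .conjL h))
      obtain ⟨s', hs'⟩ := ih2 _ r2 (fun _ h => hu _ (.conjR h)) (fun _ h => hv _ (.conjR h))
        (fun h => hF (by cases c <;> exact .conjR h))
      exact ⟨_, .conj hr' hs'⟩
  | parL hA h1 h2 ih =>
    intro v hR hu hv hF
    cases hR with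
    | base hb => exact hB _ _ hb hu hv hF _ ⟨_, .parL hA h1 h2⟩
    | par r1 r2 =>
      obtain ⟨r', hr'⟩ := ih _ r1 (fun _ h => hu _ (.parL h)) (fun _ h => hv _ (.parL h))
        (fun h => hF (by cases c <;> exact .parL h))
      exact ⟨_, .parL hA hr' (fun _ h => hv _ (.parR h))⟩
  | parR hA h1 h2 ih =>
    intro v hR hu hv hF
    cases hR with
    | base hb => exact hB _ _ hb hu hv hF _ ⟨_, .parR hA h1 h2⟩
    | par r1 r2 =>
      obtain ⟨r', hr'⟩ := ih _ r2 (fun _ h => hu _ (.parR h)) (fun _ h => hv _ (.parR h))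
        (fun h => hF (by cases c <;> exact .parR h))
      exact ⟨_, .parR hA (fun _ h => hv _ (.parL h)) hr'⟩
  | parSync hA h1 h2 ih1 ih2 =>
    intro v hR hu hv hF
    cases hR with
    | base hb => exact hB _ _ hb hu hv hF _ ⟨_, .parSync hA h1 h2⟩
    | par r1 r2 =>
      obtain ⟨r', hr'⟩ := ih1 _ r1 (fun _ h => hu _ (.parL h)) (fun _ h => hv _ (.parL h))
        (fun h => hF (by cases c <;> exact .parL h))
      obtain ⟨s', hs'⟩ := ih2 _ r2 (fun _ h => hu _ (.parR h)) (fun _ h => hv _ (.parR h))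
        (fun h => hF (by cases c <;> exact .parR h))
      exact ⟨_, .parSync hA hr' hs'⟩
  | recur hm h ih =>
    intro v hR hu hv hF
    cases hR with
    | base hb => exact hB _ _ hb hu hv hF _ ⟨_, .recur hm h⟩
    | recur L hL =>
      obtain ⟨⟨Y, s, s'⟩, he, heq⟩ := List.mem_map.1 hm
      obtain ⟨rfl, rfl⟩ := Prod.mk.inj heq
      have hm' : (Y, s') ∈ L.map (fun e => (e.1, e.2.2)) := List.mem_map.2 ⟨_, he, rfl⟩
      obtain ⟨r', hr'⟩ := ih _ (Rel.unfold hcl L hL (hL _ he))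
        (fun _ h => hu _ (.recur hm h)) (fun _ h => hv _ (.recur hm' h))
        (fun h => hF (by
          cases c
          · exact .recUnfold hm' h
          · exact .recUnfold hm h))
      exact ⟨_, .recur hm' hr'⟩

theorem RSle.ready_eq {p q : Tm Act} (h : RSle p q) (hp : Stable p) (hq : Stable q)
    (hF : ¬ Fpred p) : ready p = ready q := by
  obtain ⟨q', ⟨hseq, _⟩, R, hR, hpq⟩ := h p ⟨.refl hF, hp⟩
  cases hseq with
  | refl _ => exact (hR _ _ hpq).2.2.2.2 hF
  | step _ hs _ => exact absurd hs (hq _)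

theorem RSle.vis_iff {p q : Tm Act} (h : RSle p q) (hp : Stable p) (hq : Stable q)
    (hF : ¬ Fpred p) (a : Act) : (∃ r, VisStep p a r) ↔ ∃ r, VisStep q a r := by
  have := Set.ext_iff.1 (h.ready_eq hp hq hF) (some a)
  exact this

theorem Rel.substN {B : Tm Act → Tm Act → Prop}
    (hcl : ∀ u v, B u v → ClosedUnder ∅ u ∧ ClosedUnder ∅ v)
    {n : ℕ} {C : Tm Act} {V : Set ℕ} (hC : ClosedUnder V C) (p q : Fin n → Tm Act)
    (h : ∀ i, B (p i) (q i)) : Rel B (Tm.substN n p C) (Tm.substN n q C) := by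
  refine Rel.subst hcl (Rel.refl_closed B hC) _ _ ?_
  intro Z
  by_cases hZ : Z < n
  · simp only [dif_pos hZ]; exact .base (h _)
  · simp only [dif_neg hZ]; exact .var

/-- stable consistent instantiations of a context by pointwise
⊑_RS-related tuples have the same visible ready actions. -/
theorem same_visible_actions {Act : Type} (n : ℕ) (C : Tm Act)
    (hC : IsContext {Y | Y < n} C)
    (p q : Fin n → Tm Act)
    (hp : ∀ i, IsProcess (p i)) (hq : ∀ i, IsProcess (q i))
    (hle : ∀ i, RSle (p i) (q i))
    (hsp : Stable (substN n p C)) (hsq : Stable (substN n q C))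
    (hF : ¬ Fpred (substN n p C)) :
    ∀ a : Act, (∃ r, VisStep (substN n p C) a r) ↔
      (∃ r, VisStep (substN n q C) a r) := by
  intro a
  constructor
  · rintro ⟨r, hr⟩
    have hcl : ∀ u v, (∃ i, u = p i ∧ v = q i) → ClosedUnder ∅ u ∧ ClosedUnder ∅ v := by
      rintro u v ⟨i, rfl, rfl⟩
      exact ⟨(hp i).1, (hq i).1⟩
    refine Rel.visStep hcl true ?_ hr _
      (Rel.substN hcl hC.1 p q fun i => ⟨i, rfl, rfl⟩) hsp hsq hF
    rintro u v ⟨i, rfl, rfl⟩ hu hv hFu b hb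
    exact ((hle i).vis_iff hu hv hFu b).1 hb
  · rintro ⟨r, hr⟩
    have hcl : ∀ u v, (∃ i, u = q i ∧ v = p i) → ClosedUnder ∅ u ∧ ClosedUnder ∅ v := by
      rintro u v ⟨i, rfl, rfl⟩
      exact ⟨(hq i).1, (hp i).1⟩
    refine Rel.visStep hcl false ?_ hr _
      (Rel.substN hcl hC.1 q p fun i => ⟨i, rfl, rfl⟩) hsq hsp hF
    rintro u v ⟨i, rfl, rfl⟩ hu hv hFv b hb
    exact ((hle i).vis_iff hv hu hFv b).2 hb

end Tm
end CLLR
end
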